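/- arXiv:gr-qc/9903034 — 4 statements merged into one kernel-verified Lean document; each statement's English description precedes it below -/
import Mathlib

section
/- Under the hypotheses of the first-variation formula (a one-parameter family $M, \xi, p, \rho, n, T$ on $[0,R]\times(-\varepsilon,\varepsilon)$ with $M(0,s)=0$, $r-2M>0$, $\partial M/\partial r = 4\pi r^2\rho$, $T\xi = T_0$, $\mu/T$ independent of $r$, Gibbs–Duhem relation $\partial_s(p/T) = n\,\partial_s(\mu/T) - \rho\,\partial_s(1/T)$, and fixed particle number $\int_0^R 4\pi r^2\lambda n\,dr = N$ for all $s$, where $\lambda = (1-2M/r)^{-1/2}$), assume in addition that the configuration at $s=0$ satisfies Einstein's field equation $\partial_r\xi = \xi\,(M + 4\pi r^3 p)/(r(r-2M))$ on $(0,R]$ together with the boundary condition $\xi(R,0) = (1 - 2M(R,0)/R)^{1/2}$. Then the free energy $F(s) = M(R,s) - T_0\bigl(\int_0^R 4\pi r^2\lambda(p+\rho)/T\,dr - (\mu_0(s)/T_0)N\bigr)$ is stationary at $s=0$: $F'(0) = 0$. -/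
open Set Real intervalIntegral

/-- The radial metric function `λ(r,s) = (1 - 2M(r,s)/r)^(-1/2)` of a one-parameter
family of static, spherically symmetric configurations with mass function `M`. -/
noncomputable def lamFn (M : ℝ → ℝ → ℝ) (r s : ℝ) : ℝ :=
  (Real.sqrt (1 - 2 * M r s / r))⁻¹

open Topology Filter

/-- A `C¹` function on a box has a jointly continuous partial derivative in the open variable. -/
lemma exists_continuousOn_partial_snd {R ε : ℝ} (hR : 0 < R) {f : ℝ → ℝ → ℝ}
    (hf : ContDiffOn ℝ 1 (fun x : ℝ × ℝ => f x.1 x.2) (Icc 0 R ×ˢ Ioo (-ε) ε)) :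
    ∃ f' : ℝ → ℝ → ℝ,
      ContinuousOn (fun x : ℝ × ℝ => f' x.1 x.2) (Icc 0 R ×ˢ Ioo (-ε) ε) ∧
      ∀ r ∈ Icc 0 R, ∀ s ∈ Ioo (-ε) ε, HasDerivAt (fun s' => f r s') (f' r s) s := by
  set K : Set (ℝ × ℝ) := Icc 0 R ×ˢ Ioo (-ε) ε with hK
  have hu : UniqueDiffOn ℝ K := (uniqueDiffOn_Icc hR).prod (isOpen_Ioo.uniqueDiffOn)
  refine ⟨fun r s => fderivWithin ℝ (fun x : ℝ × ℝ => f x.1 x.2) K (r, s) (0, 1), ?_, ?_⟩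
  · exact (hf.continuousOn_fderivWithin hu le_rfl).clm_apply continuousOn_const
  · intro r hr s hs
    have h1 := ((hf.differentiableOn one_ne_zero) (r, s) ⟨hr, hs⟩).hasFDerivWithinAt
    have h2 : HasDerivWithinAt (fun s' : ℝ => (r, s')) ((0 : ℝ), (1 : ℝ)) (Ioo (-ε) ε) s :=
      ((hasDerivAt_const s r).prodMk (hasDerivAt_id s)).hasDerivWithinAt
    have h3 := h1.comp_hasDerivWithinAt s h2 (fun s' hs' => ⟨hr, hs'⟩)
    exact h3.hasDerivAt (Ioo_mem_nhds hs.1 hs.2)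

lemma differentiableAt_slice_fst {R ε : ℝ} {f : ℝ → ℝ → ℝ}
    (hf : ContDiffOn ℝ 1 (fun x : ℝ × ℝ => f x.1 x.2) (Icc 0 R ×ˢ Ioo (-ε) ε))
    {r s : ℝ} (hr : r ∈ Ioo 0 R) (hs : s ∈ Ioo (-ε) ε) :
    DifferentiableAt ℝ (fun r' => f r' s) r := by
  have h1 : DifferentiableAt ℝ (fun x : ℝ × ℝ => f x.1 x.2) (r, s) :=
    ((hf.differentiableOn one_ne_zero) (r, s) ⟨Ioo_subset_Icc_self hr, hs⟩).differentiableAt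
      (prod_mem_nhds (Icc_mem_nhds hr.1 hr.2) (Ioo_mem_nhds hs.1 hs.2))
  exact h1.comp (f := fun r' : ℝ => (r', s)) r
    (differentiableAt_id.prodMk (differentiableAt_const s))

lemma ContinuousOn.slice_fst {f : ℝ → ℝ → ℝ} {A B : Set ℝ}
    (hf : ContinuousOn (fun x : ℝ × ℝ => f x.1 x.2) (A ×ˢ B)) {s : ℝ} (hs : s ∈ B) :
    ContinuousOn (fun r => f r s) A :=
  hf.comp (f := fun r : ℝ => (r, s)) (by fun_prop) fun _ hr => ⟨hr, hs⟩

/-- Differentiation under the integral sign for a jointly continuous partial derivative. -/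
lemma hasDerivAt_integral_of_continuousOn_partial {b δ : ℝ} (hb : 0 ≤ b) (hδ : 0 < δ)
    {F F' : ℝ → ℝ → ℝ}
    (hF : ContinuousOn (fun x : ℝ × ℝ => F x.1 x.2) (Icc 0 b ×ˢ Icc (-δ) δ))
    (hF' : ContinuousOn (fun x : ℝ × ℝ => F' x.1 x.2) (Icc 0 b ×ˢ Icc (-δ) δ))
    (hd : ∀ r ∈ Icc 0 b, ∀ s ∈ Icc (-δ) δ, HasDerivAt (fun s' => F r s') (F' r s) s) :
    HasDerivAt (fun s => ∫ r in (0 : ℝ)..b, F r s) (∫ r in (0 : ℝ)..b, F' r 0) 0 := by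
  obtain ⟨C, hC⟩ := (isCompact_Icc.prod isCompact_Icc).exists_bound_of_continuousOn hF'
  have h0 : (0 : ℝ) ∈ Icc (-δ) δ := ⟨by linarith, hδ.le⟩
  have hu : uIcc 0 b = Icc 0 b := uIcc_of_le hb
  have hmem : ∀ r ∈ uIoc 0 b, r ∈ Icc 0 b := fun r hr => by
    rw [uIoc_of_le hb] at hr; exact Ioc_subset_Icc_self hr
  have hint : ∀ {g : ℝ → ℝ → ℝ},
      ContinuousOn (fun x : ℝ × ℝ => g x.1 x.2) (Icc 0 b ×ˢ Icc (-δ) δ) →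
      ∀ s ∈ Icc (-δ) δ, IntervalIntegrable (fun r => g r s) MeasureTheory.volume 0 b :=
    fun hg s hs => ContinuousOn.intervalIntegrable (by rw [hu]; exact hg.slice_fst hs)
  refine (intervalIntegral.hasDerivAt_integral_of_dominated_loc_of_deriv_le
    (F := fun s r => F r s) (F' := fun s r => F' r s) (bound := fun _ => C)
    (Icc_mem_nhds (neg_lt_zero.mpr hδ) hδ) ?_ (hint hF 0 h0) ?_ ?_ ?_ ?_).2
  · filter_upwards [Icc_mem_nhds (neg_lt_zero.mpr hδ) hδ] with s hs
    exact (hint hF s hs).aestronglyMeasurable_restrict_uIoc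
  · exact (hint hF' 0 h0).aestronglyMeasurable_restrict_uIoc
  · exact .of_forall fun r hr s hs => hC (r, s) ⟨hmem r hr, hs⟩
  · exact intervalIntegrable_const
  · exact .of_forall fun r hr s hs => hd r (hmem r hr) s hs

lemma hasDerivAt_inv_sqrt {g : ℝ → ℝ} {g' x : ℝ} (hg : HasDerivAt g g' x) (hpos : 0 < g x) :
    HasDerivAt (fun y => (√(g y))⁻¹) (-(g' / 2) * (√(g x))⁻¹ ^ 3) x := by
  have hs : √(g x) ≠ 0 := (Real.sqrt_pos.mpr hpos).ne'
  refine ((hg.sqrt hpos.ne').inv hs).congr_deriv ?_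
  field_simp

/-- **One direction of the paper's Theorem 1.** Under the hypotheses of the
first-variation formula, if the configuration at `s = 0` satisfies Einstein's field
equation `∂ᵣξ = ξ(M + 4πr³p)/(r(r-2M))` on `(0,R]` together with the boundary
condition `ξ(R) = (1 - 2M(R)/R)^(1/2)`, then the free energy `F = M - T₀S` is
stationary at `s = 0`: `F'(0) = 0`. -/
theorem einstein_implies_free_energy_stationary
    (R T0 N ε : ℝ) (hR : 0 < R) (hT0 : 0 < T0) (hε : 0 < ε)
    (M ξ p ρ n T μ : ℝ → ℝ → ℝ) (μ0 : ℝ → ℝ)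
    -- smoothness of the family (continuous differentiability, with the mixed
    -- derivatives needed continuous)
    (hMs : ContDiffOn ℝ 2 (fun x : ℝ × ℝ => M x.1 x.2) (Icc 0 R ×ˢ Ioo (-ε) ε))
    (hξs : ContDiffOn ℝ 1 (fun x : ℝ × ℝ => ξ x.1 x.2) (Icc 0 R ×ˢ Ioo (-ε) ε))
    (hps : ContDiffOn ℝ 1 (fun x : ℝ × ℝ => p x.1 x.2) (Icc 0 R ×ˢ Ioo (-ε) ε))
    (hρs : ContDiffOn ℝ 1 (fun x : ℝ × ℝ => ρ x.1 x.2) (Icc 0 R ×ˢ Ioo (-ε) ε))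
    (hns : ContDiffOn ℝ 1 (fun x : ℝ × ℝ => n x.1 x.2) (Icc 0 R ×ˢ Ioo (-ε) ε))
    (hTs : ContDiffOn ℝ 1 (fun x : ℝ × ℝ => T x.1 x.2) (Icc 0 R ×ˢ Ioo (-ε) ε))
    (hμs : ContDiffOn ℝ 1 (fun x : ℝ × ℝ => μ x.1 x.2) (Icc 0 R ×ˢ Ioo (-ε) ε))
    (hμ0s : ContDiffOn ℝ 1 μ0 (Ioo (-ε) ε))
    -- M(0,s) = 0
    (hM0 : ∀ s ∈ Ioo (-ε) ε, M 0 s = 0)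
    -- r - 2M > 0 on (0,R]
    (hhoriz : ∀ s ∈ Ioo (-ε) ε, ∀ r ∈ Ioc (0:ℝ) R, 0 < r - 2 * M r s)
    -- ∂M/∂r = 4π r² ρ
    (hMr : ∀ s ∈ Ioo (-ε) ε, ∀ r ∈ Icc (0:ℝ) R,
      deriv (fun r' => M r' s) r = 4 * π * r ^ 2 * ρ r s)
    -- T > 0 and the Tolman condition Tξ = T₀
    (hTpos : ∀ s ∈ Ioo (-ε) ε, ∀ r ∈ Icc (0:ℝ) R, 0 < T r s)
    (hTol : ∀ s ∈ Ioo (-ε) ε, ∀ r ∈ Icc (0:ℝ) R, T r s * ξ r s = T0)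
    -- μ/T = μ₀(s)/T₀ is independent of r
    (hμT : ∀ s ∈ Ioo (-ε) ε, ∀ r ∈ Icc (0:ℝ) R, μ r s / T r s = μ0 s / T0)
    -- Gibbs–Duhem relation in the variation parameter:
    -- ∂ₛ(p/T) = n ∂ₛ(μ/T) - ρ ∂ₛ(1/T)
    (hGD : ∀ s ∈ Ioo (-ε) ε, ∀ r ∈ Icc (0:ℝ) R,
      deriv (fun s' => p r s' / T r s') s
        = n r s * deriv (fun s' => μ r s' / T r s') s
          - ρ r s * deriv (fun s' => (T r s')⁻¹) s)
    -- particle number constraint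
    (hN : ∀ s ∈ Ioo (-ε) ε,
      (∫ r in (0:ℝ)..R, 4 * π * r ^ 2 * lamFn M r s * n r s) = N)
    -- Einstein's field equation at s = 0
    (hEin : ∀ r ∈ Ioc (0:ℝ) R,
      deriv (fun r' => ξ r' 0) r
        = ξ r 0 * (M r 0 + 4 * π * r ^ 3 * p r 0) / (r * (r - 2 * M r 0)))
    -- boundary condition at s = 0
    (hbc : ξ R 0 = Real.sqrt (1 - 2 * M R 0 / R)) :
    -- conclusion: the free energy F = M - T₀ S is stationary at s = 0
    deriv (fun s => M R s - T0 *
        ((∫ r in (0:ℝ)..R, 4 * π * r ^ 2 * lamFn M r s * (p r s + ρ r s) / T r s)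
          - μ0 s / T0 * N)) 0 = 0 := by
  have hpi : 0 < π := Real.pi_pos
  set δ : ℝ := ε / 2 with hδdef
  have hδ : 0 < δ := by positivity
  have hsub : Icc (-δ) δ ⊆ Ioo (-ε) ε := fun s hs =>
    ⟨by linarith [hs.1], by linarith [hs.2]⟩
  have hKsub : Icc 0 R ×ˢ Icc (-δ) δ ⊆ Icc 0 R ×ˢ Ioo (-ε) ε := prod_mono_right hsub
  have h0δ : (0 : ℝ) ∈ Icc (-δ) δ := ⟨by linarith, hδ.le⟩
  have h0ε : (0 : ℝ) ∈ Ioo (-ε) ε := hsub h0δ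
  have hM1 := hMs.of_le (show (1 : WithTop ℕ∞) ≤ 2 by norm_num)
  have hTne : ∀ x ∈ Icc 0 R ×ˢ Ioo (-ε) ε, T x.1 x.2 ≠ 0 := fun x hx =>
    (hTpos x.2 hx.2 x.1 hx.1).ne'
  have hQ := hps.div hTs hTne
  have hU := hTs.inv hTne
  obtain ⟨Ms, hMsc, hMsd⟩ := exists_continuousOn_partial_snd hR hM1
  obtain ⟨ρs, hρsc, hρsd⟩ := exists_continuousOn_partial_snd hR hρs
  obtain ⟨Qs, hQsc, hQsd⟩ :=
    exists_continuousOn_partial_snd (f := fun r s => p r s / T r s) hR hQ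
  obtain ⟨Us, hUsc, hUsd⟩ :=
    exists_continuousOn_partial_snd (f := fun r s => (T r s)⁻¹) hR hU
  have hMc := hM1.continuousOn.mono hKsub
  have hρc := hρs.continuousOn.mono hKsub
  have hQc := hQ.continuousOn.mono hKsub
  have hUc := hU.continuousOn.mono hKsub
  replace hMsc := hMsc.mono hKsub
  replace hρsc := hρsc.mono hKsub
  replace hQsc := hQsc.mono hKsub
  replace hUsc := hUsc.mono hKsub
  -- radial derivative of the mass function in the interior
  have hMrd : ∀ s ∈ Icc (-δ) δ, ∀ r ∈ Ioo 0 R,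
      HasDerivAt (fun r' => M r' s) (4 * π * r ^ 2 * ρ r s) r := by
    intro s hs r hr
    rw [← hMr s (hsub hs) r (Ioo_subset_Icc_self hr)]
    exact (differentiableAt_slice_fst hM1 hr (hsub hs)).hasDerivAt
  have hMint : ∀ s ∈ Icc (-δ) δ, ∀ r ∈ Icc 0 R,
      ∫ x in (0 : ℝ)..r, 4 * π * x ^ 2 * ρ x s = M r s := by
    intro s hs r hr
    have hss : Icc 0 r ⊆ Icc 0 R := Icc_subset_Icc_right hr.2
    rw [intervalIntegral.integral_eq_sub_of_hasDerivAt_of_le hr.1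
      ((hMc.slice_fst hs).mono hss)
      (fun x hx => hMrd s hs x ⟨hx.1, hx.2.trans_le hr.2⟩), hM0 s (hsub hs), sub_zero]
    refine ContinuousOn.intervalIntegrable ?_
    rw [uIcc_of_le hr.1]
    exact ContinuousOn.mul (by fun_prop) ((hρc.slice_fst hs).mono hss)
  have hMsint : ∀ r ∈ Icc 0 R, Ms r 0 = ∫ x in (0 : ℝ)..r, 4 * π * x ^ 2 * ρs x 0 := by
    intro r hr
    have hss : Icc 0 r ⊆ Icc 0 R := Icc_subset_Icc_right hr.2
    have hsK : Icc 0 r ×ˢ Icc (-δ) δ ⊆ Icc 0 R ×ˢ Icc (-δ) δ := prod_mono_left hss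
    have h1 := hasDerivAt_integral_of_continuousOn_partial hr.1 hδ
      (F := fun x s => 4 * π * x ^ 2 * ρ x s) (F' := fun x s => 4 * π * x ^ 2 * ρs x s)
      (ContinuousOn.mul (by fun_prop) (hρc.mono hsK))
      (ContinuousOn.mul (by fun_prop) (hρsc.mono hsK))
      (fun x hx s hs => (hρsd x (hss hx) s (hsub hs)).const_mul _)
    refine (hMsd r hr 0 h0ε).unique (h1.congr_of_eventuallyEq ?_)
    filter_upwards [Icc_mem_nhds (neg_lt_zero.mpr hδ) hδ] with s hs
    exact (hMint s hs r hr).symm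
  have hMsrd : ∀ r ∈ Ioo 0 R, HasDerivAt (fun r' => Ms r' 0) (4 * π * r ^ 2 * ρs r 0) r := by
    intro r hr
    have hc : ContinuousOn (fun x => 4 * π * x ^ 2 * ρs x 0) (Icc 0 R) :=
      ContinuousOn.mul (by fun_prop) (hρsc.slice_fst h0δ)
    have hn : Icc 0 R ∈ 𝓝 r := Icc_mem_nhds hr.1 hr.2
    have h1 : HasDerivAt (fun r' => ∫ x in (0 : ℝ)..r', 4 * π * x ^ 2 * ρs x 0)
        (4 * π * r ^ 2 * ρs r 0) r := by
      refine intervalIntegral.integral_hasDerivAt_right ?_ ?_ (hc.continuousAt hn)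
      · refine ContinuousOn.intervalIntegrable ?_
        rw [uIcc_of_le hr.1.le]
        exact hc.mono (Icc_subset_Icc_right hr.2.le)
      · exact (hc.mono Ioo_subset_Icc_self).stronglyMeasurableAtFilter isOpen_Ioo r hr
    refine h1.congr_of_eventuallyEq ?_
    filter_upwards [hn] with r' hr'
    exact hMsint r' hr'
  -- the compactness factor `1 - 2M/r` is positive and jointly continuous up to the centre
  have hνpos : ∀ s ∈ Ioo (-ε) ε, ∀ r ∈ Icc 0 R, 0 < 1 - 2 * M r s / r := by
    intro s hs r hr
    rcases hr.1.eq_or_lt with h | h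
    · simp [← h]
    · have := hhoriz s hs r ⟨h, hr.2⟩
      rw [sub_pos, div_lt_one h]
      linarith
  obtain ⟨C, hC⟩ := (isCompact_Icc.prod isCompact_Icc).exists_bound_of_continuousOn hρc
  have hMbound : ∀ s ∈ Icc (-δ) δ, ∀ r ∈ Icc 0 R, ‖M r s / r‖ ≤ 4 * π * C * r ^ 2 := by
    intro s hs r hr
    rcases hr.1.eq_or_lt with h | h
    · simp [← h]
    · have hb : ‖∫ x in (0 : ℝ)..r, 4 * π * x ^ 2 * ρ x s‖ ≤ 4 * π * r ^ 2 * C * |r - 0| := by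
        refine intervalIntegral.norm_integral_le_of_norm_le_const fun x hx => ?_
        rw [uIoc_of_le h.le] at hx
        have hρ := hC (x, s) ⟨⟨hx.1.le, hx.2.trans hr.2⟩, hs⟩
        have hx0 := hx.1.le
        rw [norm_mul, Real.norm_of_nonneg (by positivity : 0 ≤ 4 * π * x ^ 2)]
        gcongr
        exact hx.2
      rw [hMint s hs r hr, sub_zero, abs_of_pos h] at hb
      rw [norm_div, Real.norm_of_nonneg h.le, div_le_iff₀ h]
      linarith
  have hmc : ContinuousOn (fun x : ℝ × ℝ => M x.1 x.2 / x.1) (Icc 0 R ×ˢ Icc (-δ) δ) := by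
    rintro ⟨r, s⟩ ⟨hr, hs⟩
    rcases hr.1.eq_or_lt with h | h
    · simp only at h
      subst h
      have hlim : Tendsto (fun x : ℝ × ℝ => 4 * π * C * x.1 ^ 2)
          (𝓝[Icc 0 R ×ˢ Icc (-δ) δ] ((0 : ℝ), s)) (𝓝 0) := by
        have : Continuous (fun x : ℝ × ℝ => 4 * π * C * x.1 ^ 2) := by fun_prop
        simpa using (this.tendsto ((0 : ℝ), s)).mono_left nhdsWithin_le_nhds
      have := squeeze_zero_norm' (f := fun x : ℝ × ℝ => M x.1 x.2 / x.1)
        (by filter_upwards [self_mem_nhdsWithin] with x hx using hMbound x.2 hx.2 x.1 hx.1) hlim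
      simpa [ContinuousWithinAt] using this
    · exact (hMc (r, s) ⟨hr, hs⟩).div continuous_fst.continuousWithinAt h.ne'
  have hlc : ContinuousOn (fun x : ℝ × ℝ => lamFn M x.1 x.2) (Icc 0 R ×ˢ Icc (-δ) δ) := by
    unfold lamFn
    refine ContinuousOn.inv₀ (ContinuousOn.sqrt ?_) fun x hx =>
      (Real.sqrt_pos.mpr (hνpos x.2 (hsub hx.2) x.1 hx.1)).ne'
    refine continuousOn_const.sub ((hmc.const_mul 2).congr fun x _ => ?_)
    ring
  have hld : ∀ r ∈ Icc 0 R, ∀ s ∈ Icc (-δ) δ,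
      HasDerivAt (fun s' => lamFn M r s') (Ms r s / r * lamFn M r s ^ 3) s := by
    intro r hr s hs
    have h1 := (((hMsd r hr s (hsub hs)).const_mul 2).div_const r).const_sub 1
    refine (hasDerivAt_inv_sqrt h1 (hνpos s (hsub hs) r hr)).congr_deriv ?_
    simp only [lamFn]
    ring
  -- differentiate the entropy integral
  have hS := hasDerivAt_integral_of_continuousOn_partial hR.le hδ
    (F := fun r s => 4 * π * r ^ 2 * lamFn M r s * (p r s / T r s + ρ r s * (T r s)⁻¹))
    (F' := fun r s => 4 * π * r * Ms r s * lamFn M r s ^ 3 * (p r s / T r s + ρ r s * (T r s)⁻¹)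
      + 4 * π * r ^ 2 * lamFn M r s * (Qs r s + (ρs r s * (T r s)⁻¹ + ρ r s * Us r s)))
    ((ContinuousOn.mul (by fun_prop) hlc).mul (hQc.add (hρc.mul hUc)))
    (((((ContinuousOn.mul (by fun_prop) hMsc).mul (hlc.pow 3)).mul (hQc.add (hρc.mul hUc)))).add
      ((ContinuousOn.mul (by fun_prop) hlc).mul (hQsc.add ((hρsc.mul hUc).add (hρc.mul hUsc)))))
    (by
      intro r hr s hs
      have hs' := hsub hs
      refine (((hld r hr s hs).const_mul (4 * π * r ^ 2)).mul
        ((hQsd r hr s hs').add ((hρsd r hr s hs').mul (hUsd r hr s hs')))).congr_deriv ?_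
      congr 2
      rcases eq_or_ne r 0 with h | h
      · simp [h]
      · field_simp)
  have hμ0d : HasDerivAt μ0 (deriv μ0 0) 0 :=
    (((hμ0s.differentiableOn one_ne_zero) 0 h0ε).differentiableAt
      (Ioo_mem_nhds h0ε.1 h0ε.2)).hasDerivAt
  have hGD0 : ∀ r ∈ Icc 0 R, Qs r 0 = n r 0 * (deriv μ0 0 / T0) - ρ r 0 * Us r 0 := by
    intro r hr
    have h1 := hGD 0 h0ε r hr
    have h2 : (fun s' => μ r s' / T r s') =ᶠ[𝓝 0] fun s' => μ0 s' / T0 := by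
      filter_upwards [Ioo_mem_nhds h0ε.1 h0ε.2] with s hs using hμT s hs r hr
    rwa [(hQsd r hr 0 h0ε).deriv, (hUsd r hr 0 h0ε).deriv, h2.deriv_eq,
      (hμ0d.div_const T0).deriv] at h1
  -- by Einstein's equation the reduced integrand is the derivative of `λ ξ ∂ₛM`
  have hξc : ContinuousOn (fun r => ξ r 0) (Icc 0 R) := hξs.continuousOn.slice_fst h0ε
  have hlc0 := hlc.slice_fst h0δ
  have hfluxint : IntervalIntegrable (fun r =>
      4 * π * r * Ms r 0 * lamFn M r 0 ^ 3 * (p r 0 + ρ r 0) * ξ r 0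
        + 4 * π * r ^ 2 * lamFn M r 0 * ρs r 0 * ξ r 0) MeasureTheory.volume 0 R := by
    refine ContinuousOn.intervalIntegrable ?_
    rw [uIcc_of_le hR.le]
    have hpc : ContinuousOn (fun r => p r 0) (Icc 0 R) := hps.continuousOn.slice_fst h0ε
    exact (((((ContinuousOn.mul (by fun_prop) (hMsc.slice_fst h0δ)).mul (hlc0.pow 3)).mul
      (hpc.add (hρc.slice_fst h0δ))).mul hξc)).add
      (((ContinuousOn.mul (by fun_prop) hlc0).mul (hρsc.slice_fst h0δ)).mul hξc)
  have hflux : ∫ r in (0 : ℝ)..R,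
      (4 * π * r * Ms r 0 * lamFn M r 0 ^ 3 * (p r 0 + ρ r 0) * ξ r 0
        + 4 * π * r ^ 2 * lamFn M r 0 * ρs r 0 * ξ r 0) = Ms R 0 := by
    rw [intervalIntegral.integral_eq_sub_of_hasDerivAt_of_le
      (f := fun r => lamFn M r 0 * ξ r 0 * Ms r 0) hR.le
      ((hlc0.mul hξc).mul (hMsc.slice_fst h0δ))]
    · have h1 : lamFn M R 0 * ξ R 0 = 1 := by
        rw [hbc, lamFn]
        exact inv_mul_cancel₀ (Real.sqrt_pos.mpr (hνpos 0 h0ε R ⟨hR.le, le_rfl⟩)).ne'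
      have h2 : Ms 0 0 = 0 := by
        rw [hMsint 0 ⟨le_rfl, hR.le⟩, intervalIntegral.integral_same]
      rw [h1, h2]
      ring
    · intro r hr
      have hr0 : r ≠ 0 := hr.1.ne'
      have hrI := Ioo_subset_Icc_self hr
      have hξd : HasDerivAt (fun r' => ξ r' 0)
          (ξ r 0 * (M r 0 + 4 * π * r ^ 3 * p r 0) / (r * (r - 2 * M r 0))) r := by
        rw [← hEin r ⟨hr.1, hr.2.le⟩]
        exact (differentiableAt_slice_fst hξs hr h0ε).hasDerivAt
      have hν := ((((hMrd 0 h0δ r hr).const_mul 2).div (hasDerivAt_id r) hr0).const_sub 1)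
      have hl := hasDerivAt_inv_sqrt hν (hνpos 0 h0ε r hrI)
      have hsq : lamFn M r 0 ^ 2 * (r - 2 * M r 0) = r := by
        have hp := hνpos 0 h0ε r hrI
        rw [lamFn, inv_pow, Real.sq_sqrt hp.le, inv_mul_eq_div, div_eq_iff hp.ne']
        field_simp
      have hden : r - 2 * M r 0 ≠ 0 := (hhoriz 0 h0ε r ⟨hr.1, hr.2.le⟩).ne'
      refine ((hl.mul hξd).mul (hMsrd r hr)).congr_deriv ?_
      change (-(-((2 * (4 * π * r ^ 2 * ρ r 0) * r - 2 * M r 0 * 1) / r ^ 2) / 2)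
        * lamFn M r 0 ^ 3 * ξ r 0
        + lamFn M r 0 * (ξ r 0 * (M r 0 + 4 * π * r ^ 3 * p r 0) / (r * (r - 2 * M r 0))))
          * Ms r 0 + lamFn M r 0 * ξ r 0 * (4 * π * r ^ 2 * ρs r 0) = _
      have hinv : (r * (r - 2 * M r 0))⁻¹ = lamFn M r 0 ^ 2 / r ^ 2 := by
        rw [inv_eq_one_div, div_eq_div_iff (mul_ne_zero hr0 hden) (pow_ne_zero 2 hr0)]
        linear_combination (-r) * hsq
      rw [div_eq_mul_inv _ (r * (r - 2 * M r 0)), hinv]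
      field_simp
      ring
    · exact hfluxint
  have hNc : IntervalIntegrable (fun r => 4 * π * r ^ 2 * lamFn M r 0 * n r 0)
      MeasureTheory.volume 0 R := by
    refine ContinuousOn.intervalIntegrable ?_
    rw [uIcc_of_le hR.le]
    exact (ContinuousOn.mul (by fun_prop) hlc0).mul (hns.continuousOn.slice_fst h0ε)
  have hvar : T0 * (∫ r in (0 : ℝ)..R,
      (4 * π * r * Ms r 0 * lamFn M r 0 ^ 3 * (p r 0 / T r 0 + ρ r 0 * (T r 0)⁻¹)
      + 4 * π * r ^ 2 * lamFn M r 0 * (Qs r 0 + (ρs r 0 * (T r 0)⁻¹ + ρ r 0 * Us r 0))))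
      = Ms R 0 + deriv μ0 0 * N := by
    rw [← hflux, ← hN 0 h0ε, ← intervalIntegral.integral_const_mul,
      ← intervalIntegral.integral_const_mul, ← intervalIntegral.integral_add ?_
        (hNc.const_mul _)]
    · refine intervalIntegral.integral_congr fun r hr => ?_
      rw [uIcc_of_le hR.le] at hr
      have hT : T r 0 ≠ 0 := (hTpos 0 h0ε r hr).ne'
      have hξ : ξ r 0 = T0 / T r 0 := by
        rw [eq_div_iff hT, mul_comm]; exact hTol 0 h0ε r hr
      simp only [hGD0 r hr, hξ]
      field_simp
      ring
    · exact hfluxint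
  have hF := (hMsd R ⟨hR.le, le_rfl⟩ 0 h0ε).sub
    ((hS.sub ((hμ0d.div_const T0).mul_const N)).const_mul T0)
  have hint : ∀ s, (∫ r in (0 : ℝ)..R, 4 * π * r ^ 2 * lamFn M r s * (p r s + ρ r s) / T r s)
      = ∫ r in (0 : ℝ)..R,
        4 * π * r ^ 2 * lamFn M r s * (p r s / T r s + ρ r s * (T r s)⁻¹) := fun s => by
    congr 1
    ext r
    ring
  simp only [hint]
  refine hF.deriv.trans ?_
  rw [mul_sub, hvar]
  field_simp
  ring
end

section
/- For parameters $m > 0$, $\alpha > 0$, $g > 0$, the Thomas–Fermi equation-of-state functions $n_F$, $\rho_F$ and $p_F$ are infinitely differentiable ($C^\infty$) on the interval $(0,\infty)$. -/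
open Set Real MeasureTheory

/-- The relativistic single-particle energy `E(q) = √(m² + q²)`. -/
noncomputable def fermiE (m q : ℝ) : ℝ := Real.sqrt (m ^ 2 + q ^ 2)

/-- The Fermi distribution factor `f(q,ψ) = (1 + exp(α(ψE(q) - m)/m))⁻¹`,
where `ψ` parametrizes the local temperature `T = m/(αψ)` and chemical
potential `μ = m/ψ`. -/
noncomputable def fermiF (m α ψ q : ℝ) : ℝ :=
  (1 + Real.exp (α * (ψ * fermiE m q - m) / m))⁻¹

/-- Thomas–Fermi number density `n_F(ψ) = (g/2π²) ∫₀^∞ q² f(q,ψ) dq`. -/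
noncomputable def nF (m α g ψ : ℝ) : ℝ :=
  g / (2 * π ^ 2) * ∫ q in Ioi (0:ℝ), q ^ 2 * fermiF m α ψ q

/-- Thomas–Fermi energy density `ρ_F(ψ) = (g/2π²) ∫₀^∞ q² E(q) f(q,ψ) dq`. -/
noncomputable def rhoF (m α g ψ : ℝ) : ℝ :=
  g / (2 * π ^ 2) * ∫ q in Ioi (0:ℝ), q ^ 2 * fermiE m q * fermiF m α ψ q

/-- Thomas–Fermi pressure `p_F(ψ) = (g/6π²) ∫₀^∞ (q⁴/E(q)) f(q,ψ) dq`. -/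
noncomputable def pF (m α g ψ : ℝ) : ℝ :=
  g / (6 * π ^ 2) * ∫ q in Ioi (0:ℝ), q ^ 4 / fermiE m q * fermiF m α ψ q

lemma fermiE_pos {m : ℝ} (hm : 0 < m) (q : ℝ) : 0 < fermiE m q :=
  Real.sqrt_pos.2 (by positivity)

lemma le_fermiE (m q : ℝ) : q ≤ fermiE m q :=
  Real.le_sqrt_of_sq_le (by nlinarith [sq_nonneg m])

lemma continuous_fermiE (m : ℝ) : Continuous (fermiE m) := by
  unfold fermiE
  fun_prop

lemma fermiF_pos (m α ψ q : ℝ) : 0 < fermiF m α ψ q := by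
  unfold fermiF
  positivity

lemma fermiF_le_one (m α ψ q : ℝ) : fermiF m α ψ q ≤ 1 :=
  inv_le_one_of_one_le₀ (by linarith [Real.exp_pos (α * (ψ * fermiE m q - m) / m)])

lemma continuous_fermiF (m α ψ : ℝ) : Continuous (fermiF m α ψ) := by
  unfold fermiF
  have := continuous_fermiE m
  exact Continuous.inv₀ (by fun_prop) fun q => by positivity

/-- Boltzmann tail bound for the Fermi factor, uniform for `ψ ≥ ε`. -/
lemma fermiF_le_exp {m α ε ψ : ℝ} (hm : 0 < m) (hα : 0 < α) (hψ : ε ≤ ψ) (q : ℝ) :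
    fermiF m α ψ q ≤ Real.exp α * Real.exp (-(α * ε / m * fermiE m q)) := by
  have hE := fermiE_pos hm q
  calc fermiF m α ψ q ≤ (Real.exp (α * (ψ * fermiE m q - m) / m))⁻¹ :=
        inv_anti₀ (Real.exp_pos _) (by linarith)
    _ = Real.exp (α - α * ψ / m * fermiE m q) := by
        rw [← Real.exp_neg]
        congr 1
        field_simp
        ring
    _ ≤ Real.exp (α - α * ε / m * fermiE m q) := by gcongr
    _ = _ := by rw [← Real.exp_add, sub_eq_add_neg]

/-- The Fermi factor solves the logistic equation in `ψ`. -/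
lemma hasDerivAt_fermiF (m α ψ q : ℝ) :
    HasDerivAt (fun x => fermiF m α x q)
      (α / m * fermiE m q * (fermiF m α ψ q * (fermiF m α ψ q - 1))) ψ := by
  have h1 : HasDerivAt (fun x => 1 + Real.exp (α * (x * fermiE m q - m) / m))
      (Real.exp (α * (ψ * fermiE m q - m) / m) * (α * (1 * fermiE m q) / m)) ψ :=
    ((((((hasDerivAt_id ψ).mul_const _).sub_const _).const_mul α).div_const m).exp).const_add 1
  have hpos : 1 + Real.exp (α * (ψ * fermiE m q - m) / m) ≠ 0 := by positivity
  refine (h1.fun_inv hpos).congr_deriv ?_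
  unfold fermiF
  generalize Real.exp (α * (ψ * fermiE m q - m) / m) = e at *
  field_simp
  ring

lemma integrableOn_fermiE_pow_mul_exp {m c : ℝ} (hm : 0 < m) (hc : 0 < c) (n : ℕ) :
    IntegrableOn (fun q => fermiE m q ^ n * Real.exp (-(c * fermiE m q))) (Ioi 0) := by
  have hc2 : 0 < c / 2 := by positivity
  have hE := continuous_fermiE m
  refine Integrable.mono' ((exp_neg_integrableOn_Ioi 0 hc2).const_mul
    (n.factorial / (c / 2) ^ n)) (by fun_prop) ?_
  refine Filter.Eventually.of_forall fun q => ?_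
  have hpos := fermiE_pos hm q
  rw [Real.norm_of_nonneg (by positivity)]
  have h1 := Real.pow_div_factorial_le_exp (c / 2 * fermiE m q) (by positivity) n
  rw [mul_pow, div_le_iff₀ (by positivity)] at h1
  have h2 : fermiE m q ^ n ≤ n.factorial / (c / 2) ^ n * Real.exp (c / 2 * fermiE m q) := by
    rw [div_mul_eq_mul_div, le_div_iff₀ (by positivity)]
    linarith
  calc fermiE m q ^ n * Real.exp (-(c * fermiE m q))
      ≤ n.factorial / (c / 2) ^ n * Real.exp (c / 2 * fermiE m q)
          * Real.exp (-(c * fermiE m q)) := by gcongr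
    _ = n.factorial / (c / 2) ^ n * Real.exp (-(c / 2) * fermiE m q) := by
        rw [mul_assoc, ← Real.exp_add]
        ring_nf
    _ ≤ _ := by
        have := mul_le_mul_of_nonneg_left (le_fermiE m q) hc2.le
        gcongr ?_ * Real.exp ?_
        linarith

/-- Moments `∫ w Eᵏ f Q(f)`, a family closed under differentiation in `ψ`. -/
noncomputable def fermiMoment (m α : ℝ) (w : ℝ → ℝ) (k : ℕ) (Q : Polynomial ℝ) (ψ : ℝ) : ℝ :=
  ∫ q in Ioi (0:ℝ), w q * fermiE m q ^ k * (fermiF m α ψ q * Q.eval (fermiF m α ψ q))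

lemma exists_abs_eval_fermiF_le (m α : ℝ) (Q : Polynomial ℝ) :
    ∃ C, 0 ≤ C ∧ ∀ ψ q, |Q.eval (fermiF m α ψ q)| ≤ C := by
  obtain ⟨C, hC⟩ := (isCompact_Icc (a := (0:ℝ)) (b := 1)).exists_bound_of_continuousOn
    Q.continuous.continuousOn
  exact ⟨C, (norm_nonneg _).trans (hC 0 (by simp)), fun ψ q =>
    hC _ ⟨(fermiF_pos m α ψ q).le, fermiF_le_one m α ψ q⟩⟩

lemma exists_fermiMoment_bound {m α ε : ℝ} (hm : 0 < m) (hα : 0 < α) (hε : 0 < ε) {w : ℝ → ℝ}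
    {j : ℕ} (hb : ∀ q, |w q| ≤ fermiE m q ^ j) (k : ℕ) (Q : Polynomial ℝ) :
    ∃ B : ℝ → ℝ, IntegrableOn B (Ioi 0) ∧ ∀ ψ, ε ≤ ψ → ∀ q,
      ‖w q * fermiE m q ^ k * (fermiF m α ψ q * Q.eval (fermiF m α ψ q))‖ ≤ B q := by
  obtain ⟨C, hC0, hC⟩ := exists_abs_eval_fermiF_le m α Q
  refine ⟨_, (integrableOn_fermiE_pow_mul_exp hm (c := α * ε / m) (by positivity)
    (j + k)).const_mul (Real.exp α * C), fun ψ hψ q => ?_⟩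
  have hE := fermiE_pos hm q
  have hF := fermiF_pos m α ψ q
  rw [Real.norm_eq_abs, abs_mul, abs_mul, abs_mul, abs_of_pos hF, abs_of_pos (pow_pos hE k)]
  calc |w q| * fermiE m q ^ k * (fermiF m α ψ q * |Q.eval (fermiF m α ψ q)|)
      ≤ fermiE m q ^ j * fermiE m q ^ k *
          (Real.exp α * Real.exp (-(α * ε / m * fermiE m q)) * C) := by
        gcongr
        · exact hb q
        · exact fermiF_le_exp hm hα hψ q
        · exact hC ψ q
    _ = _ := by ring

lemma hasDerivAt_fermiMoment {m α ψ : ℝ} (hm : 0 < m) (hα : 0 < α) (hψ : 0 < ψ) {w : ℝ → ℝ}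
    (hw : Continuous w) {j : ℕ} (hb : ∀ q, |w q| ≤ fermiE m q ^ j) (k : ℕ) (Q : Polynomial ℝ) :
    HasDerivAt (fermiMoment m α w k Q)
      (α / m * fermiMoment m α w (k + 1)
        ((Q + Polynomial.X * Polynomial.derivative Q) * (Polynomial.X - 1)) ψ) ψ := by
  set R : Polynomial ℝ := (Q + Polynomial.X * Polynomial.derivative Q) * (Polynomial.X - 1) with hR
  have hε : 0 < ψ / 2 := by positivity
  have hcont (k : ℕ) (P : Polynomial ℝ) (x : ℝ) : Continuous fun q =>
      w q * fermiE m q ^ k * (fermiF m α x q * P.eval (fermiF m α x q)) := by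
    have h1 := continuous_fermiE m
    have h2 := continuous_fermiF m α x
    have h3 := P.continuous.comp h2
    exact (hw.mul (h1.pow k)).mul (h2.mul h3)
  obtain ⟨B, hBi, hB⟩ := exists_fermiMoment_bound hm hα hε hb k Q
  obtain ⟨D, hDi, hD⟩ := exists_fermiMoment_bound hm hα hε hb (k + 1) R
  have key := hasDerivAt_integral_of_dominated_loc_of_deriv_le
    (μ := volume.restrict (Ioi (0:ℝ))) (x₀ := ψ) (s := Ioi (ψ / 2))
    (F := fun x q => w q * fermiE m q ^ k * (fermiF m α x q * Q.eval (fermiF m α x q)))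
    (F' := fun x q => α / m *
      (w q * fermiE m q ^ (k + 1) * (fermiF m α x q * R.eval (fermiF m α x q))))
    (bound := fun q => α / m * D q)
    (Ioi_mem_nhds (by linarith))
    (Filter.Eventually.of_forall fun x => (hcont k Q x).aestronglyMeasurable)
    (hBi.mono' (hcont k Q ψ).aestronglyMeasurable
      (Filter.Eventually.of_forall (hB ψ (by linarith))))
    ((hcont (k + 1) R ψ).aestronglyMeasurable.const_mul _)
    (Filter.Eventually.of_forall fun q x hx => by
      rw [norm_mul, Real.norm_of_nonneg (by positivity : 0 ≤ α / m)]
      exact mul_le_mul_of_nonneg_left (hD x (le_of_lt hx) q) (by positivity))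
    (hDi.const_mul _)
    (Filter.Eventually.of_forall fun q x _ => by
      have h1 := hasDerivAt_fermiF m α x q
      have h2 := (Q.hasDerivAt (fermiF m α x q)).comp x h1
      refine ((h1.mul h2).const_mul (w q * fermiE m q ^ k)).congr_deriv ?_
      simp [hR]
      ring)
  have h := key.2
  rw [integral_const_mul] at h
  exact h

lemma contDiffOn_fermiMoment {m α : ℝ} (hm : 0 < m) (hα : 0 < α) {w : ℝ → ℝ}
    (hw : Continuous w) {j : ℕ} (hb : ∀ q, |w q| ≤ fermiE m q ^ j) (k : ℕ) (Q : Polynomial ℝ) :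
    ContDiffOn ℝ (⊤ : ℕ∞) (fermiMoment m α w k Q) (Ioi 0) := by
  refine contDiffOn_infty.2 fun n => ?_
  induction n generalizing k Q with
  | zero =>
    exact contDiffOn_zero.2 fun ψ hψ =>
      (hasDerivAt_fermiMoment hm hα hψ hw hb k Q).continuousAt.continuousWithinAt
  | succ n ih =>
    push_cast
    refine (contDiffOn_succ_iff_deriv_of_isOpen isOpen_Ioi).2 ⟨fun ψ hψ =>
      (hasDerivAt_fermiMoment hm hα hψ hw hb k Q).differentiableAt.differentiableWithinAt,
      by simp, ?_⟩
    exact (contDiffOn_const.mul (ih _ _)).congr fun ψ hψ =>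
      (hasDerivAt_fermiMoment hm hα hψ hw hb k Q).deriv

lemma contDiffOn_const_mul_integral_fermiF {m α : ℝ} (hm : 0 < m) (hα : 0 < α) (c : ℝ)
    {w : ℝ → ℝ} (hw : Continuous w) {j : ℕ} (hb : ∀ q, |w q| ≤ fermiE m q ^ j) :
    ContDiffOn ℝ (⊤ : ℕ∞) (fun ψ => c * ∫ q in Ioi (0:ℝ), w q * fermiF m α ψ q) (Ioi 0) := by
  refine contDiffOn_const.mul ((contDiffOn_fermiMoment hm hα hw hb 0 1).congr fun ψ _ => ?_)
  simp [fermiMoment]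

/-- The Thomas–Fermi equation-of-state functions `n_F`, `ρ_F`, `p_F` are
infinitely differentiable on `(0,∞)`. -/
theorem thomas_fermi_eos_smooth
    (m α g : ℝ) (hm : 0 < m) (hα : 0 < α) (hg : 0 < g) :
    ContDiffOn ℝ (⊤ : ℕ∞) (nF m α g) (Ioi (0:ℝ)) ∧
    ContDiffOn ℝ (⊤ : ℕ∞) (rhoF m α g) (Ioi (0:ℝ)) ∧
    ContDiffOn ℝ (⊤ : ℕ∞) (pF m α g) (Ioi (0:ℝ)) := by
  have hE := continuous_fermiE m
  have hsq (q : ℝ) : q ^ 2 ≤ fermiE m q ^ 2 := by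
    rw [fermiE, Real.sq_sqrt (by positivity)]
    nlinarith [sq_nonneg m]
  refine ⟨contDiffOn_const_mul_integral_fermiF hm hα _ (j := 2) (by fun_prop) fun q => ?_,
    contDiffOn_const_mul_integral_fermiF hm hα _ (j := 3) (by fun_prop) fun q => ?_,
    contDiffOn_const_mul_integral_fermiF hm hα _ (j := 3)
      (Continuous.div (by fun_prop) hE fun q => (fermiE_pos hm q).ne') fun q => ?_⟩
  · rw [abs_of_nonneg (by positivity)]
    exact hsq q
  · have hpos := fermiE_pos hm q
    rw [abs_of_nonneg (by positivity), pow_succ _ 2]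
    exact mul_le_mul_of_nonneg_right (hsq q) hpos.le
  · have hpos := fermiE_pos hm q
    rw [abs_of_nonneg (by positivity), div_le_iff₀ hpos]
    calc q ^ 4 = (q ^ 2) ^ 2 := by ring
      _ ≤ (fermiE m q ^ 2) ^ 2 := pow_le_pow_left₀ (by positivity) (hsq q) 2
      _ = _ := by ring
end

section
/- For parameters $m > 0$, $\alpha > 0$, $g > 0$, the high-density limit of the energy density holds: $\lim_{\psi \to 0^+} \psi^4\, \rho_F(\psi) = \dfrac{g\, m^4}{2\pi^2} \int_0^\infty \dfrac{x^3}{1 + e^{\alpha(x-1)}}\, dx$. -/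
open Set Real MeasureTheory

/-- In the rescaled momentum `q = (m/ψ) x`, the energy density is an integral whose dependence on
`ψ` is regular at `ψ = 0`. -/
theorem pow_four_mul_rhoF {m ψ : ℝ} (α g : ℝ) (hm : 0 < m) (hψ : 0 < ψ) :
    ψ ^ 4 * rhoF m α g ψ = g * m ^ 4 / (2 * π ^ 2) *
      ∫ x in Ioi (0:ℝ), x ^ 2 * fermiE ψ x / (1 + Real.exp (α * (fermiE ψ x - 1))) := by
  have hc : 0 < m / ψ := div_pos hm hψ
  have hE (x : ℝ) : fermiE m (m / ψ * x) = m / ψ * fermiE ψ x := by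
    unfold fermiE
    rw [← Real.sqrt_sq hc.le, ← Real.sqrt_mul (sq_nonneg _), Real.sqrt_sq hc.le]
    congr 1
    field_simp
  have key := integral_comp_mul_left_Ioi
    (fun q => q ^ 2 * fermiE m q * fermiF m α ψ q) 0 hc
  have hint (x : ℝ) : (m / ψ * x) ^ 2 * fermiE m (m / ψ * x) * fermiF m α ψ (m / ψ * x) =
      (m / ψ) ^ 3 * (x ^ 2 * fermiE ψ x / (1 + Real.exp (α * (fermiE ψ x - 1)))) := by
    have harg : α * (ψ * (m / ψ * fermiE ψ x) - m) / m = α * (fermiE ψ x - 1) := by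
      field_simp
    rw [fermiF, hE, harg]
    ring
  simp only [hint, mul_zero, smul_eq_mul, integral_const_mul] at key
  rw [rhoF]
  have hJ := (inv_mul_eq_iff_eq_mul₀ hc.ne').mp key.symm
  rw [hJ]
  field_simp

/-- A polynomial times a decaying exponential is integrable on the half-line. -/
theorem integrableOn_pow_mul_exp_neg_mul (n : ℕ) {b : ℝ} (hb : 0 < b) :
    IntegrableOn (fun x : ℝ => x ^ n * Real.exp (-b * x)) (Ioi 0) := by
  simpa using integrableOn_rpow_mul_exp_neg_mul_rpow (p := 1) (s := n) (b := b)
    (by linarith [n.cast_nonneg (α := ℝ)]) zero_lt_one hb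

/-- High-density limit of the energy density:
`ψ⁴ ρ_F(ψ) → (g m⁴/2π²) ∫₀^∞ x³/(1+e^{α(x-1)}) dx` as `ψ → 0⁺`. -/
theorem thomas_fermi_high_density_energy
    (m α g : ℝ) (hm : 0 < m) (hα : 0 < α) (hg : 0 < g) :
    Filter.Tendsto (fun ψ => ψ ^ 4 * rhoF m α g ψ) (nhdsWithin 0 (Ioi 0))
      (nhds (g * m ^ 4 / (2 * π ^ 2) *
        ∫ x in Ioi (0:ℝ), x ^ 3 / (1 + Real.exp (α * (x - 1))))) := by
  have hlim : Filter.Tendsto (fun ψ : ℝ => ∫ x in Ioi (0:ℝ),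
      x ^ 2 * fermiE ψ x / (1 + Real.exp (α * (fermiE ψ x - 1)))) (nhdsWithin 0 (Ioi 0))
      (nhds (∫ x in Ioi (0:ℝ), x ^ 3 / (1 + Real.exp (α * (x - 1))))) := by
    refine tendsto_integral_filter_of_dominated_convergence
      (fun x => Real.exp α * (x ^ 2 * Real.exp (-α * x) + x ^ 3 * Real.exp (-α * x)))
      ?_ ?_ ?_ ?_
    · refine Filter.Eventually.of_forall fun ψ => Measurable.aestronglyMeasurable ?_
      unfold fermiE
      fun_prop
    · filter_upwards [Ioo_mem_nhdsGT (zero_lt_one' ℝ)] with ψ hψ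
      filter_upwards [ae_restrict_mem measurableSet_Ioi] with x hx
      have hx : 0 < x := hx
      have hlow : x ≤ fermiE ψ x := Real.le_sqrt_of_sq_le (by nlinarith [sq_nonneg ψ])
      have hup : fermiE ψ x ≤ 1 + x :=
        Real.sqrt_le_iff.mpr ⟨by linarith, by nlinarith [hψ.1, hψ.2]⟩
      have hE : 0 ≤ fermiE ψ x := hx.le.trans hlow
      rw [Real.norm_of_nonneg (by positivity)]
      calc x ^ 2 * fermiE ψ x / (1 + Real.exp (α * (fermiE ψ x - 1)))
          ≤ x ^ 2 * (1 + x) / Real.exp (α * (x - 1)) := by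
            gcongr
            have : Real.exp (α * (x - 1)) ≤ Real.exp (α * (fermiE ψ x - 1)) := by gcongr
            linarith
        _ = Real.exp α * (x ^ 2 * Real.exp (-α * x) + x ^ 3 * Real.exp (-α * x)) := by
            rw [div_eq_mul_inv, ← Real.exp_neg,
              show -(α * (x - 1)) = α + -α * x by ring, Real.exp_add]
            ring
    · exact ((integrableOn_pow_mul_exp_neg_mul 2 hα).add
        (integrableOn_pow_mul_exp_neg_mul 3 hα)).const_mul _
    · filter_upwards [ae_restrict_mem measurableSet_Ioi] with x hx
      have hx : 0 < x := hx
      have hcont : Continuous fun ψ : ℝ =>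
          x ^ 2 * fermiE ψ x / (1 + Real.exp (α * (fermiE ψ x - 1))) := by
        unfold fermiE
        exact Continuous.div (by fun_prop) (by fun_prop) fun ψ => by positivity
      have h0 : fermiE 0 x = x := by simp [fermiE, Real.sqrt_sq hx.le]
      have ht := (hcont.tendsto 0).mono_left (nhdsWithin_le_nhds (s := Ioi 0))
      rwa [h0, ← pow_succ] at ht
  refine (hlim.const_mul _).congr' ?_
  filter_upwards [self_mem_nhdsWithin] with ψ hψ
  exact (pow_four_mul_rhoF α g hm hψ).symm
end

section
/- Free energy scaling. In the setting of the scaling property of the Thomas–Fermi equation (a solution $\psi, \mathcal{M}$ on $(0,R]$ with parameters $m, \alpha, g, \mu_0$ and particle number $N$, rescaled by $A > 0$ to $\tilde\psi(r) = \psi(r/A)$, $\tilde{\mathcal{M}}(r) = A\mathcal{M}(r/A)$ with $\tilde m = A^{-1/2}m$, $\tilde\mu_0 = A^{-1/2}\mu_0$, $\tilde R = AR$, $\tilde N = A^{3/2}N$), define the free energy $F = \mathcal{M}(R) - \int_0^R 4\pi r^2 \lambda(r)\, \xi(r)\, \bigl(p_F^{(m)}(\psi(r)) + \rho_F^{(m)}(\psi(r))\bigr)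 dr + \mu_0 N$, where $\lambda = (1 - 2\mathcal{M}/r)^{-1/2}$ and $\xi = (\mu_0/m)\psi$, and let $\tilde F$ be the corresponding quantity for the rescaled configuration. Then $\tilde F = A\, F$. -/
open Set Real MeasureTheory

theorem fermiE_mul_mul {c : ℝ} (hc : 0 < c) (m q : ℝ) :
    fermiE (c * m) (c * q) = c * fermiE m q := by
  unfold fermiE
  rw [show (c * m) ^ 2 + (c * q) ^ 2 = c ^ 2 * (m ^ 2 + q ^ 2) by ring,
    Real.sqrt_mul (sq_nonneg c), Real.sqrt_sq hc.le]

theorem fermiF_mul_mul {c : ℝ} (hc : 0 < c) (m α ψ q : ℝ) :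
    fermiF (c * m) α ψ (c * q) = fermiF m α ψ q := by
  unfold fermiF
  rw [fermiE_mul_mul hc,
    show α * (ψ * (c * fermiE m q) - c * m) = c * (α * (ψ * fermiE m q - m)) by ring,
    mul_div_mul_left _ _ hc.ne']

theorem setIntegral_Ioi_zero_of_homogeneous {c k : ℝ} (hc : 0 < c) {f h : ℝ → ℝ}
    (hfh : ∀ q, f (c * q) = k * h q) :
    ∫ q in Ioi (0 : ℝ), f q = c * k * ∫ q in Ioi (0 : ℝ), h q := by
  have key := integral_comp_mul_left_Ioi f 0 hc
  simp only [hfh, integral_const_mul, mul_zero, smul_eq_mul] at key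
  rw [mul_assoc, key, mul_inv_cancel_left₀ hc.ne']

/-- The energy density is homogeneous of degree four in the mass. -/
theorem rhoF_mul_mass {c : ℝ} (hc : 0 < c) (m α g ψ : ℝ) :
    rhoF (c * m) α g ψ = c ^ 4 * rhoF m α g ψ := by
  unfold rhoF
  rw [setIntegral_Ioi_zero_of_homogeneous (k := c ^ 3)
    (h := fun q ↦ q ^ 2 * fermiE m q * fermiF m α ψ q) hc]
  · ring
  · intro q
    rw [fermiE_mul_mul hc, fermiF_mul_mul hc]
    ring

/-- The pressure is homogeneous of degree four in the mass. -/
theorem pF_mul_mass {c : ℝ} (hc : 0 < c) (m α g ψ : ℝ) :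
    pF (c * m) α g ψ = c ^ 4 * pF m α g ψ := by
  unfold pF
  rw [setIntegral_Ioi_zero_of_homogeneous (k := c ^ 3)
    (h := fun q ↦ q ^ 4 / fermiE m q * fermiF m α ψ q) hc]
  · ring
  · intro q
    rw [fermiE_mul_mul hc, fermiF_mul_mul hc,
      show (c * q) ^ 4 = c * (c ^ 3 * q ^ 4) by ring, mul_div_mul_left _ _ hc.ne']
    ring

/-- **Free energy scaling.** In the setting of the scaling property of the
Thomas–Fermi equation (a solution `ψ, M` on `(0,R]` with parameters `m, α, g, μ₀`
and particle number `N`, rescaled by `A > 0` to `ψ̃(r) = ψ(r/A)`,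
`M̃(r) = A·M(r/A)` with `m̃ = A^{-1/2}m`, `μ̃₀ = A^{-1/2}μ₀`, `R̃ = AR`,
`Ñ = A^{3/2}N`), the free energy
`F = M(R) - ∫₀ᴿ 4πr² λ ξ (p_F(ψ)+ρ_F(ψ)) dr + μ₀N`, with
`λ = (1-2M/r)^{-1/2}` and `ξ = (μ₀/m)ψ`, scales as `F̃ = A·F`. -/
theorem thomas_fermi_free_energy_scaling
    (A α g m μ0 R : ℝ) (hA : 0 < A) (hα : 0 < α) (hg : 0 < g)
    (hm : 0 < m) (hμ0 : 0 < μ0) (hR : 0 < R)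
    (ψ M : ℝ → ℝ) (N : ℝ)
    (hψd : ∀ r ∈ Ioc (0:ℝ) R, DifferentiableAt ℝ ψ r)
    (hMd : ∀ r ∈ Ioc (0:ℝ) R, DifferentiableAt ℝ M r)
    (hhoriz : ∀ r ∈ Ioc (0:ℝ) R, 0 < r - 2 * M r)
    (hM0 : Filter.Tendsto M (nhdsWithin 0 (Ioi 0)) (nhds 0))
    (hfield1 : ∀ r ∈ Ioc (0:ℝ) R,
      deriv ψ r = ψ r * (M r + 4 * π * r ^ 3 * pF m α g (ψ r))
        / (r * (r - 2 * M r)))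
    (hfield2 : ∀ r ∈ Ioc (0:ℝ) R,
      deriv M r = 4 * π * r ^ 2 * rhoF m α g (ψ r))
    (hbc : ψ R = m / μ0 * Real.sqrt (1 - 2 * M R / R))
    (hN : N = ∫ r in (0:ℝ)..R,
      4 * π * r ^ 2 * (Real.sqrt (1 - 2 * M r / r))⁻¹ * nF m α g (ψ r)) :
    -- the free energy F̃ of the rescaled configuration equals A·F
    (A * M (A * R / A)
        - (∫ r in (0:ℝ)..(A * R),
            4 * π * r ^ 2 * (Real.sqrt (1 - 2 * (A * M (r / A)) / r))⁻¹
              * ((A ^ (-(1:ℝ)/2) * μ0) / (A ^ (-(1:ℝ)/2) * m) * ψ (r / A))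
              * (pF (A ^ (-(1:ℝ)/2) * m) α g (ψ (r / A))
                  + rhoF (A ^ (-(1:ℝ)/2) * m) α g (ψ (r / A))))
        + (A ^ (-(1:ℝ)/2) * μ0) * (A ^ ((3:ℝ)/2) * N))
      = A * (M R
          - (∫ r in (0:ℝ)..R,
              4 * π * r ^ 2 * (Real.sqrt (1 - 2 * M r / r))⁻¹
                * (μ0 / m * ψ r)
                * (pF m α g (ψ r) + rhoF m α g (ψ r)))
          + μ0 * N) := by
  have hc : 0 < A ^ (-(1:ℝ)/2) := rpow_pos_of_pos hA _
  have hc4 : A ^ 2 * (A ^ (-(1:ℝ)/2)) ^ 4 = 1 := by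
    rw [← rpow_natCast (A ^ (-(1:ℝ)/2)), ← rpow_natCast A, ← rpow_mul hA.le, ← rpow_add hA]
    norm_num
  have hc3 : A ^ (-(1:ℝ)/2) * A ^ ((3:ℝ)/2) = A := by
    rw [← rpow_add hA]
    norm_num
  simp only [rhoF_mul_mass hc, pF_mul_mass hc, mul_div_mul_left _ _ hc.ne',
    mul_div_cancel_left₀ R hA.ne']
  generalize A ^ (-(1:ℝ)/2) = c at *
  have hint : (∫ r in (0:ℝ)..(A * R),
      4 * π * r ^ 2 * (Real.sqrt (1 - 2 * (A * M (r / A)) / r))⁻¹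
        * (μ0 / m * ψ (r / A))
        * (c ^ 4 * pF m α g (ψ (r / A)) + c ^ 4 * rhoF m α g (ψ (r / A))))
      = A * ∫ r in (0:ℝ)..R,
        4 * π * r ^ 2 * (Real.sqrt (1 - 2 * M r / r))⁻¹
          * (μ0 / m * ψ r) * (pF m α g (ψ r) + rhoF m α g (ψ r)) := by
    rw [← mul_zero A, ← intervalIntegral.mul_integral_comp_mul_left, mul_zero]
    congr 1
    refine intervalIntegral.integral_congr fun r _ ↦ ?_
    simp only [mul_div_cancel_left₀ r hA.ne', mul_left_comm 2 A, mul_div_mul_left _ _ hA.ne']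
    linear_combination (4 * π * r ^ 2 * (Real.sqrt (1 - 2 * M r / r))⁻¹
      * (μ0 / m * ψ r) * (pF m α g (ψ r) + rhoF m α g (ψ r))) * hc4
  rw [hint]
  linear_combination μ0 * N * hc3
end
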